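/- arXiv:1111.0094 — 2 statements merged into one kernel-verified Lean document; each statement's English description precedes it below -/
import Mathlib

section
/- For every non-negative integer n, Q_5(5n + 4) ≡ 0 (mod 5), where Q_5(m) is the total number of parts equal to 5 among all partitions of m. -/
/-- Number of partitions of `n`. -/
def P (n : ℕ) : ℕ := Fintype.card (Nat.Partition n)

/-- Partition function extended to `ℤ`, zero for negative arguments. -/
def PZ (z : ℤ) : ℕ := if z < 0 then 0 else P z.toNat

/-- Total number of occurrences of the part `k` over all partitions of `n`. -/
def Q (k n : ℕ) : ℕ := ∑ p : Nat.Partition n, Multiset.count k p.parts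

/-- `Q` extended to `ℤ`, zero for non-positive arguments. -/
def QZ (k : ℕ) (z : ℤ) : ℕ := if z ≤ 0 then 0 else Q k z.toNat

/-- Sum over all partitions of `n` of the number of distinct part-sizes. -/
def S (n : ℕ) : ℕ := ∑ p : Nat.Partition n, p.parts.toFinset.card

/-- Number of pairs `(λ, m)` with `λ` a partition of `n` and `m` a part-size
occurring at least `k` times in `λ`. -/
def V (k n : ℕ) : ℕ :=
  ∑ p : Nat.Partition n, (p.parts.toFinset.filter (fun m => k ≤ p.parts.count m)).card

/-- `comp5 i f` keeps the terms of `f` with exponent congruent to `i` mod 5. -/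
noncomputable def comp5 (i : ZMod 5) (f : PowerSeries (ZMod 5)) : PowerSeries (ZMod 5) :=
  PowerSeries.mk fun n => if (n : ZMod 5) = i then PowerSeries.coeff n f else 0

/-- `f` only has exponents congruent to `i` mod 5. -/
def Sup5 (i : ZMod 5) (f : PowerSeries (ZMod 5)) : Prop :=
  ∀ n : ℕ, (n : ZMod 5) ≠ i → PowerSeries.coeff n f = 0

theorem five_cast_zero : ((5 : ℕ) : ZMod 5) = 0 := by decide

theorem five_zero : (5 : ZMod 5) = 0 := by decide

theorem sup5_comp5 (i : ZMod 5) (f : PowerSeries (ZMod 5)) : Sup5 i (comp5 i f) := by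
  intro n hn
  simp [comp5, hn]

theorem Sup5.mul {i j : ZMod 5} {f g : PowerSeries (ZMod 5)} (hf : Sup5 i f) (hg : Sup5 j g) :
    Sup5 (i + j) (f * g) := by
  intro n hn
  rw [PowerSeries.coeff_mul]
  refine Finset.sum_eq_zero fun x hx => ?_
  rw [Finset.HasAntidiagonal.mem_antidiagonal] at hx
  by_cases h1 : (x.1 : ZMod 5) = i
  · by_cases h2 : (x.2 : ZMod 5) = j
    · exact absurd (by rw [← hx, ← h1, ← h2]; push_cast; rfl) hn
    · rw [hg _ h2, mul_zero]
  · rw [hf _ h1, zero_mul]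

theorem Sup5.add {i : ZMod 5} {f g : PowerSeries (ZMod 5)} (hf : Sup5 i f) (hg : Sup5 i g) :
    Sup5 i (f + g) := by
  intro n hn
  rw [map_add, hf n hn, hg n hn, add_zero]

theorem Sup5.pow {i : ZMod 5} {f : PowerSeries (ZMod 5)} (hf : Sup5 i f) (k : ℕ) :
    Sup5 (k * i) (f ^ k) := by
  induction k with
  | zero =>
    intro n hn
    rw [pow_zero, PowerSeries.coeff_one, if_neg]
    rintro rfl
    simp at hn
  | succ k ih =>
    have := ih.mul hf
    rw [pow_succ]
    convert this using 1
    push_cast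
    ring

/-- The sign of `k`. -/
def sgn5 (k : ℤ) : ZMod 5 := if Even k then 1 else -1

theorem sgn5_eq (k : ℤ) : ((Int.negOnePow k : ℤ) : ZMod 5) = sgn5 k := by
  unfold sgn5
  split_ifs with h
  · rw [Int.negOnePow_even k h]; simp
  · rw [Int.negOnePow_odd k (by simpa using h)]; simp

theorem abs_le_pentagonal (k : ℤ) : |k| ≤ (pentagonal k : ℤ) := by
  have h := two_mul_natCast_pentagonal k
  rcases le_total 0 k with hk | hk
  · rw [abs_of_nonneg hk]
    rcases hk.eq_or_lt with h0 | h0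
    · subst h0; simp
    · nlinarith
  · rw [abs_of_nonpos hk]
    rcases hk.eq_or_lt with h0 | h0
    · subst h0; simp
    · nlinarith

theorem coeff_pent (n B : ℕ) (h : n ≤ B) :
    PowerSeries.coeff n (PowerSeries.pentagonalSeries (ZMod 5)) =
      ∑ k ∈ Finset.Icc (-(B : ℤ)) B, if pentagonal k = n then sgn5 k else 0 := by
  by_cases hn : n ∈ Set.range pentagonal
  · obtain ⟨k, rfl⟩ := hn
    rw [PowerSeries.coeff_pentagonalSeries_pentagonal, sgn5_eq]
    simp only [pentagonal_inj]
    rw [Finset.sum_ite_eq', if_pos]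
    have := abs_le_pentagonal k
    rw [Finset.mem_Icc, ← abs_le]
    omega
  · rw [PowerSeries.coeff_pentagonalSeries_eq_zero _ hn]
    symm
    refine Finset.sum_eq_zero fun k _ => if_neg ?_
    rintro rfl
    exact hn ⟨k, rfl⟩

theorem coeff_comp5_mul (i j : ZMod 5) (N : ℕ) :
    PowerSeries.coeff N (comp5 i (PowerSeries.pentagonalSeries (ZMod 5)) *
      comp5 j (PowerSeries.pentagonalSeries (ZMod 5))) =
    ∑ x ∈ (Finset.Icc (-(N : ℤ)) N ×ˢ Finset.Icc (-(N : ℤ)) N).filter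
        (fun x => pentagonal x.1 + pentagonal x.2 = N),
      if (pentagonal x.1 : ZMod 5) = i ∧ (pentagonal x.2 : ZMod 5) = j
        then sgn5 x.1 * sgn5 x.2 else 0 := by
  have key : ∀ (i : ZMod 5) (n : ℕ), n ≤ N →
      PowerSeries.coeff n (comp5 i (PowerSeries.pentagonalSeries (ZMod 5))) =
      ∑ k ∈ Finset.Icc (-(N : ℤ)) N,
        if pentagonal k = n then (if (pentagonal k : ZMod 5) = i then sgn5 k else 0) else 0 := by
    intro i n hn
    rw [comp5, PowerSeries.coeff_mk, coeff_pent n N hn]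
    split_ifs with h
    · refine Finset.sum_congr rfl fun k _ => ?_
      split_ifs with h1 h2 h2
      · rfl
      · subst h1; exact absurd h h2
      · rfl
    · symm
      refine Finset.sum_eq_zero fun k _ => ?_
      split_ifs with h1 h2
      · subst h1; exact absurd h2 h
      · rfl
      · rfl
  rw [PowerSeries.coeff_mul, Finset.sum_filter, Finset.sum_product]
  have : ∀ x ∈ Finset.HasAntidiagonal.antidiagonal N,
      PowerSeries.coeff x.1 (comp5 i (PowerSeries.pentagonalSeries (ZMod 5))) *
      PowerSeries.coeff x.2 (comp5 j (PowerSeries.pentagonalSeries (ZMod 5))) =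
      ∑ k ∈ Finset.Icc (-(N : ℤ)) N, ∑ l ∈ Finset.Icc (-(N : ℤ)) N,
        if (pentagonal k, pentagonal l) = x then
          (if (pentagonal k : ZMod 5) = i ∧ (pentagonal l : ZMod 5) = j
            then sgn5 k * sgn5 l else 0) else 0 := by
    intro x hx
    rw [Finset.HasAntidiagonal.mem_antidiagonal] at hx
    rw [key i x.1 (by omega), key j x.2 (by omega), Finset.sum_mul_sum]
    refine Finset.sum_congr rfl fun k _ => Finset.sum_congr rfl fun l _ => ?_
    simp only [Prod.ext_iff]
    by_cases h1 : pentagonal k = x.1 <;> by_cases h2 : pentagonal l = x.2 <;>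
      by_cases h3 : (pentagonal k : ZMod 5) = i <;>
      by_cases h4 : (pentagonal l : ZMod 5) = j <;> simp [h1, h2, h3, h4] <;> simp_all
  rw [Finset.sum_congr rfl this, Finset.sum_comm]
  refine Finset.sum_congr rfl fun k _ => ?_
  rw [Finset.sum_comm]
  refine Finset.sum_congr rfl fun l _ => ?_
  rw [Finset.sum_ite_eq]
  simp only [Finset.HasAntidiagonal.mem_antidiagonal]

/-- The finite set of pairs whose pentagonal numbers sum to `N`. -/
noncomputable def pairs5 (N : ℕ) : Finset (ℤ × ℤ) :=
  (Finset.Icc (-(N : ℤ)) N ×ˢ Finset.Icc (-(N : ℤ)) N).filter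
        (fun x => pentagonal x.1 + pentagonal x.2 = N)

theorem mem_pairs5 (N : ℕ) (x : ℤ × ℤ) :
    x ∈ pairs5 N ↔ pentagonal x.1 + pentagonal x.2 = N := by
  have h1 := abs_le_pentagonal x.1
  have h2 := abs_le_pentagonal x.2
  rw [pairs5, Finset.mem_filter, Finset.mem_product, Finset.mem_Icc, Finset.mem_Icc, ← abs_le,
    ← abs_le]
  constructor
  · exact fun h => h.2
  · intro h
    refine ⟨⟨?_, ?_⟩, h⟩ <;> omega

theorem mem_pairs5' (N : ℕ) (x : ℤ × ℤ) :
    x ∈ pairs5 N ↔ x.1 * (3 * x.1 - 1) + x.2 * (3 * x.2 - 1) = 2 * N := by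
  rw [mem_pairs5, ← two_mul_natCast_pentagonal, ← two_mul_natCast_pentagonal]
  omega

theorem sum_A (N : ℕ) :
    ∑ x ∈ (pairs5 N).filter (fun x => (5 : ℤ) ∣ 3 * x.1 - 4 * x.2 + 1),
      sgn5 x.1 * sgn5 x.2 = 0 := by
  have hs : ∀ x ∈ (pairs5 N).filter (fun x => (5 : ℤ) ∣ 3 * x.1 - 4 * x.2 + 1),
      sgn5 x.1 * sgn5 x.2 + sgn5 ((3 * x.1 - 4 * x.2 + 1) / 5) *
        sgn5 ((-4 * x.1 - 3 * x.2 + 2) / 5) = 0 := by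
    intro x hx
    rw [Finset.mem_filter] at hx
    obtain ⟨a, ha⟩ := hx.2
    have hb : (-4 * x.1 - 3 * x.2 + 2) / 5 = 2 * a - 2 * x.1 + x.2 := by omega
    have ha' : (3 * x.1 - 4 * x.2 + 1) / 5 = a := by omega
    rw [hb, ha']
    unfold sgn5
    simp only [Int.even_iff]
    split_ifs <;> first | omega | simp
  refine Finset.sum_involution
    (fun x _ => ((3 * x.1 - 4 * x.2 + 1) / 5, (-4 * x.1 - 3 * x.2 + 2) / 5)) hs ?_ ?_ ?_
  · intro x hx h0 h
    have h1 := hs x hx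
    have e1 := congrArg Prod.fst h
    have e2 := congrArg Prod.snd h
    dsimp only at e1 e2
    rw [e1, e2] at h1
    apply h0
    have : ∀ z : ZMod 5, z + z = 0 → z = 0 := by decide
    exact this _ h1
  · intro x hx
    rw [Finset.mem_filter, mem_pairs5'] at hx ⊢
    obtain ⟨a, ha⟩ := hx.2
    have hb : (-4 * x.1 - 3 * x.2 + 2) / 5 = 2 * a - 2 * x.1 + x.2 := by omega
    have ha' : (3 * x.1 - 4 * x.2 + 1) / 5 = a := by omega
    dsimp only
    rw [hb, ha']
    refine ⟨?_, by omega⟩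
    rw [← hx.1]
    have h3 : 3 * x.1 = 5 * a + 4 * x.2 - 1 := by omega
    -- `a` is determined by `x`
    nlinarith [congrArg (fun t => t * a) h3, congrArg (fun t => t * x.1) h3,
      congrArg (fun t => t * x.2) h3]
  · intro x hx
    rw [Finset.mem_filter] at hx
    obtain ⟨a, ha⟩ := hx.2
    apply Prod.ext
    · dsimp only; omega
    · dsimp only; omega

theorem sum_B (N : ℕ) :
    ∑ x ∈ (pairs5 N).filter (fun x => (5 : ℤ) ∣ 3 * x.2 - 4 * x.1 + 1),
      sgn5 x.1 * sgn5 x.2 = 0 := by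
  rw [← sum_A N]
  refine Finset.sum_bij (fun x _ => (x.2, x.1)) ?_ ?_ ?_ ?_
  · intro x hx
    rw [Finset.mem_filter, mem_pairs5] at hx ⊢
    exact ⟨by rw [add_comm]; exact hx.1, hx.2⟩
  · intro x _ y _ h
    rw [Prod.ext_iff] at h ⊢
    exact ⟨h.2, h.1⟩
  · intro x hx
    refine ⟨(x.2, x.1), ?_, rfl⟩
    rw [Finset.mem_filter, mem_pairs5] at hx ⊢
    exact ⟨by rw [add_comm]; exact hx.1, hx.2⟩
  · intro x _
    exact mul_comm _ _

theorem pent_mod (k : ℤ) : (pentagonal k : ZMod 5) = 3 * (k * (3 * k - 1)) := by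
  have h := congrArg (Int.cast : ℤ → ZMod 5) (two_mul_natCast_pentagonal k)
  push_cast at h
  rw [← h, ← mul_assoc, show (3 * 2 : ZMod 5) = 1 from by decide, one_mul]

theorem comp_rel :
    comp5 0 (PowerSeries.pentagonalSeries (ZMod 5)) *
      comp5 2 (PowerSeries.pentagonalSeries (ZMod 5)) +
    comp5 1 (PowerSeries.pentagonalSeries (ZMod 5)) *
      comp5 1 (PowerSeries.pentagonalSeries (ZMod 5)) = 0 := by
  set φ := PowerSeries.pentagonalSeries (ZMod 5) with hφ
  have h2 : comp5 0 φ * comp5 2 φ + comp5 2 φ * comp5 0 φ + (comp5 1 φ * comp5 1 φ +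
      comp5 1 φ * comp5 1 φ) = 0 := by
    ext N
    rw [map_add, map_add, map_add, coeff_comp5_mul, coeff_comp5_mul, coeff_comp5_mul, map_zero,
      ← Finset.sum_add_distrib, ← Finset.sum_add_distrib, ← Finset.sum_add_distrib]
    have := congrArg₂ (· + ·) (sum_A N) (sum_B N)
    rw [add_zero, Finset.sum_filter, Finset.sum_filter, ← Finset.sum_add_distrib] at this
    refine Eq.trans (Finset.sum_congr rfl fun x _ => ?_) this
    have d1 : (5 : ℤ) ∣ 3 * x.1 - 4 * x.2 + 1 ↔ (3 * x.1 - 4 * x.2 + 1 : ZMod 5) = 0 := by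
      rw [← Nat.cast_ofNat (R := ℤ) (n := 5), ← ZMod.intCast_zmod_eq_zero_iff_dvd]
      push_cast
      rfl
    have d2 : (5 : ℤ) ∣ 3 * x.2 - 4 * x.1 + 1 ↔ (3 * x.2 - 4 * x.1 + 1 : ZMod 5) = 0 := by
      rw [← Nat.cast_ofNat (R := ℤ) (n := 5), ← ZMod.intCast_zmod_eq_zero_iff_dvd]
      push_cast
      rfl
    simp only [d1, d2, pent_mod]
    generalize sgn5 x.1 * sgn5 x.2 = s
    generalize (x.1 : ZMod 5) = a
    generalize (x.2 : ZMod 5) = b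
    revert a b s
    decide
  have h3 : (3 : PowerSeries (ZMod 5)) * (comp5 0 φ * comp5 2 φ + comp5 2 φ * comp5 0 φ +
      (comp5 1 φ * comp5 1 φ + comp5 1 φ * comp5 1 φ)) = 0 := by rw [h2, mul_zero]
  have h5 : (5 : PowerSeries (ZMod 5)) = 0 := by
    have : PowerSeries.C (5 : ZMod 5) = 0 := by
      rw [show (5 : ZMod 5) = 0 from by decide, map_zero]
    rw [← this, map_ofNat]
  linear_combination h3 - (comp5 0 φ * comp5 2 φ + comp5 1 φ * comp5 1 φ) * h5

theorem phi_split :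
    PowerSeries.pentagonalSeries (ZMod 5) = comp5 0 (PowerSeries.pentagonalSeries (ZMod 5)) +
      comp5 1 (PowerSeries.pentagonalSeries (ZMod 5)) +
      comp5 2 (PowerSeries.pentagonalSeries (ZMod 5)) := by
  ext n
  simp only [map_add, comp5, PowerSeries.coeff_mk]
  by_cases hn : n ∈ Set.range pentagonal
  · obtain ⟨k, rfl⟩ := hn
    generalize PowerSeries.coeff (pentagonal k) (PowerSeries.pentagonalSeries (ZMod 5)) = c
    rw [pent_mod]
    generalize (k : ZMod 5) = a
    revert a c
    decide
  · rw [PowerSeries.coeff_pentagonalSeries_eq_zero _ hn]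
    simp

theorem coeff_phi_four (n : ℕ) (hn : (n : ZMod 5) = 4) :
    PowerSeries.coeff n (PowerSeries.pentagonalSeries (ZMod 5) ^ 4) = 0 := by
  have hr := comp_rel
  have h0 := sup5_comp5 0 (PowerSeries.pentagonalSeries (ZMod 5))
  have h1 := sup5_comp5 1 (PowerSeries.pentagonalSeries (ZMod 5))
  have h2 := sup5_comp5 2 (PowerSeries.pentagonalSeries (ZMod 5))
  rw [phi_split]
  generalize comp5 0 (PowerSeries.pentagonalSeries (ZMod 5)) = a at *
  generalize comp5 1 (PowerSeries.pentagonalSeries (ZMod 5)) = b at *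
  generalize comp5 2 (PowerSeries.pentagonalSeries (ZMod 5)) = c at *
  have h5 : (5 : PowerSeries (ZMod 5)) = 0 := by
    have : PowerSeries.C (5 : ZMod 5) = 0 := by
      rw [show (5 : ZMod 5) = 0 from by decide, map_zero]
    rw [← this, map_ofNat]
  have mono : ∀ i j k : ℕ, (i * 0 + j * 1 + k * 2 : ZMod 5) ≠ 4 →
      ∀ m : ℕ, PowerSeries.coeff n ((m : PowerSeries (ZMod 5)) * (a ^ i * b ^ j * c ^ k)) = 0 := by
    intro i j k h m
    rw [← nsmul_eq_mul, map_nsmul, ((h0.pow i).mul (h1.pow j)).mul (h2.pow k) n ?_, smul_zero]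
    rw [hn]
    exact h.symm
  have e : (a + b + c) ^ 4 =
      ((1 : ℕ) : PowerSeries (ZMod 5)) * (a ^ 4 * b ^ 0 * c ^ 0) +
      ((4 : ℕ) : PowerSeries (ZMod 5)) * (a ^ 3 * b ^ 1 * c ^ 0) +
      ((4 : ℕ) : PowerSeries (ZMod 5)) * (a ^ 3 * b ^ 0 * c ^ 1) +
      ((6 : ℕ) : PowerSeries (ZMod 5)) * (a ^ 2 * b ^ 2 * c ^ 0) +
      ((12 : ℕ) : PowerSeries (ZMod 5)) * (a ^ 2 * b ^ 1 * c ^ 1) +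
      ((4 : ℕ) : PowerSeries (ZMod 5)) * (a ^ 1 * b ^ 3 * c ^ 0) +
      ((12 : ℕ) : PowerSeries (ZMod 5)) * (a ^ 1 * b ^ 1 * c ^ 2) +
      ((4 : ℕ) : PowerSeries (ZMod 5)) * (a ^ 1 * b ^ 0 * c ^ 3) +
      ((4 : ℕ) : PowerSeries (ZMod 5)) * (a ^ 0 * b ^ 3 * c ^ 1) +
      ((6 : ℕ) : PowerSeries (ZMod 5)) * (a ^ 0 * b ^ 2 * c ^ 2) +
      ((4 : ℕ) : PowerSeries (ZMod 5)) * (a ^ 0 * b ^ 1 * c ^ 3) +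
      ((1 : ℕ) : PowerSeries (ZMod 5)) * (a ^ 0 * b ^ 0 * c ^ 4) := by
    push_cast
    linear_combination (a * c + b * b) * hr + (a ^ 2 * c ^ 2 + 2 * a * b ^ 2 * c) * h5
  rw [e]
  simp only [map_add]
  rw [mono, mono, mono, mono, mono, mono, mono, mono, mono, mono, mono, mono]
  · simp
  all_goals decide

theorem sup5_phi_five : Sup5 0 (PowerSeries.pentagonalSeries (ZMod 5) ^ 5) := by
  have : Fact (Nat.Prime 5) := ⟨by norm_num⟩
  have : CharP (PowerSeries (ZMod 5)) 5 := by
    exact charP_of_injective_algebraMap (R := ZMod 5) (FaithfulSMul.algebraMap_injective _ _) 5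
  rw [phi_split, add_pow_char, add_pow_char]
  have h : ∀ i : ZMod 5, Sup5 0 (comp5 i (PowerSeries.pentagonalSeries (ZMod 5)) ^ 5) := by
    intro i
    have := (sup5_comp5 i (PowerSeries.pentagonalSeries (ZMod 5))).pow 5
    rwa [five_cast_zero, zero_mul] at this
  exact ((h 0).add (h 1)).add (h 2)

open scoped PowerSeries.WithPiTopology in
theorem P_mul_phi :
    (PowerSeries.mk fun n => (P n : ZMod 5)) * PowerSeries.pentagonalSeries (ZMod 5) = 1 := by
  let : TopologicalSpace (ZMod 5) := ⊥
  have : DiscreteTopology (ZMod 5) := ⟨rfl⟩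
  have h1 := Nat.Partition.hasProd_powerSeriesMk_card_restricted (ZMod 5) (fun _ => True)
  have h2 := h1.mul (PowerSeries.WithPiTopology.hasProd_one_sub_X_pow (ZMod 5))
  have h3 : ∀ b : ℕ, (if True then ∑' (j : ℕ), (PowerSeries.X : PowerSeries (ZMod 5)) ^ ((b + 1) * j)
      else 1) * (1 - PowerSeries.X ^ (b + 1)) = 1 := by
    intro b
    simp_rw [if_true, pow_mul]
    exact PowerSeries.WithPiTopology.tsum_pow_mul_one_sub_of_constantCoeff_eq_zero (by simp)
  simp_rw [h3] at h2
  have h4 := h2.unique hasProd_one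
  rw [← h4]
  congr 2
  funext n
  simp [P, Nat.Partition.restricted]

theorem ramanujan5 (n : ℕ) : ((P (5 * n + 4) : ℕ) : ZMod 5) = 0 := by
  set φ := PowerSeries.pentagonalSeries (ZMod 5) with hφ
  set p : PowerSeries (ZMod 5) := PowerSeries.mk fun n => (P n : ZMod 5) with hp
  have hpφ : p * φ = 1 := P_mul_phi
  have h : p * φ ^ 5 = φ ^ 4 := by linear_combination φ ^ 4 * hpφ
  have hs : Sup5 0 (φ ^ 5) := sup5_phi_five
  have h0 : comp5 4 p * φ ^ 5 = 0 := by
    ext m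
    rw [map_zero]
    by_cases hm : (m : ZMod 5) = 4
    · rw [← coeff_phi_four m hm, ← hφ, ← h, PowerSeries.coeff_mul, PowerSeries.coeff_mul]
      refine Finset.sum_congr rfl fun x hx => ?_
      rw [Finset.HasAntidiagonal.mem_antidiagonal] at hx
      by_cases h2 : (x.2 : ZMod 5) = 0
      · have : (x.1 : ZMod 5) = 4 := by
          rw [← hm, ← hx]; push_cast; rw [h2, add_zero]
        rw [comp5, PowerSeries.coeff_mk, if_pos this]
      · rw [hs _ h2, mul_zero, mul_zero]
    · exact (sup5_comp5 4 p).mul hs m (by rwa [add_zero])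
  have : Fact (Nat.Prime 5) := ⟨by norm_num⟩
  have hφ0 : φ ^ 5 ≠ 0 := by
    apply pow_ne_zero
    intro h
    rw [h, mul_zero] at hpφ
    exact zero_ne_one hpφ
  have h1 := (mul_eq_zero.mp h0).resolve_right hφ0
  have h2 := congrArg (PowerSeries.coeff (5 * n + 4)) h1
  rw [comp5, PowerSeries.coeff_mk, if_pos, hp, PowerSeries.coeff_mk, map_zero] at h2
  · exact h2
  · push_cast
    rw [five_zero]
    simp

theorem Q_rec (m : ℕ) : Q 5 (m + 5) = Q 5 m + P m := by
  have h1 : Q 5 (m + 5) =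
      ∑ p ∈ Finset.univ.filter (fun p : (m + 5).Partition => 5 ∈ p.parts), p.parts.count 5 := by
    unfold Q
    rw [Finset.sum_filter_of_ne]
    intro p _ h
    exact Multiset.count_ne_zero.mp h
  have h2 : Q 5 m + P m = ∑ p : m.Partition, (p.parts.count 5 + 1) := by
    rw [Finset.sum_add_distrib]
    simp [Q, P]
  rw [h1, h2]
  symm
  refine Finset.sum_bij (fun p _ => ⟨5 ::ₘ p.parts, ?_, ?_⟩) ?_ ?_ ?_ ?_
  · intro i hi
    rcases Multiset.mem_cons.mp hi with h | h
    · omega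
    · exact p.parts_pos h
  · rw [Multiset.sum_cons, p.parts_sum, add_comm]
  · intro p _
    simp
  · intro p _ q _ h
    have := congrArg Nat.Partition.parts h
    exact Nat.Partition.ext ((Multiset.cons_inj_right 5).mp this)
  · intro q hq
    rw [Finset.mem_filter] at hq
    refine ⟨⟨q.parts.erase 5, ?_, ?_⟩, Finset.mem_univ _, ?_⟩
    · intro i hi
      exact q.parts_pos (Multiset.mem_of_mem_erase hi)
    · have := Multiset.sum_erase hq.2
      rw [q.parts_sum] at this
      omega
    · exact Nat.Partition.ext (Multiset.cons_erase hq.2)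
  · intro p _
    simp

theorem stmt_7 (n : ℕ) : Q 5 (5 * n + 4) ≡ 0 [MOD 5] := by
  rw [← ZMod.natCast_eq_natCast_iff, Nat.cast_zero]
  induction n with
  | zero =>
    unfold Q
    rw [Finset.sum_eq_zero]
    · simp
    · intro p _
      rw [Multiset.count_eq_zero]
      intro h
      have := Nat.Partition.le_of_mem_parts h
      omega
  | succ n ih =>
    rw [show 5 * (n + 1) + 4 = 5 * n + 4 + 5 by ring, Q_rec, Nat.cast_add, ih, ramanujan5, add_zero]
end

section
/- For every non-negative integer n, Q_7(7n + 5) ≡ 0 (mod 7), where Q_7(m) is the total number of parts equal to 7 among all partitions of m. -/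
namespace Ram
open Finset PowerSeries

abbrev A := PowerSeries (ZMod 7)
instance : Fact (Nat.Prime 7) := ⟨by norm_num⟩

noncomputable def qp (n : ℕ) : A := ∏ i ∈ range n, (1 - X ^ (i + 1))

lemma qp_succ (n : ℕ) : qp (n + 1) = qp n * (1 - X ^ (n + 1)) := prod_range_succ _ _

lemma qp_zero : qp 0 = 1 := rfl

lemma qp_const (n : ℕ) : constantCoeff (qp n) = 1 := by
  induction n with
  | zero => simp [qp_zero]
  | succ n ih => rw [qp_succ]; simp [ih]

lemma qp_ne (n : ℕ) : qp n ≠ 0 := by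
  intro h
  have := qp_const n
  rw [h] at this
  simp at this

lemma qp_dvd (a c : ℕ) : (X : A) ^ (a + 1) ∣ qp (a + c) - qp a := by
  induction c with
  | zero => simp
  | succ c ih =>
    have : qp (a + (c + 1)) - qp a = (qp (a + c) - qp a) + X ^ (a + 1) * (- X ^ c * qp (a + c)) := by
      rw [← add_assoc, qp_succ]; ring
    rw [this]
    exact dvd_add ih (dvd_mul_right _ _)

noncomputable def pol (N : ℕ) : Polynomial A :=
  ∏ j ∈ range N, (Polynomial.X - Polynomial.C ((X : A) ^ j))

lemma pol_succ (N : ℕ) : pol (N + 1) = pol N * (Polynomial.X - Polynomial.C ((X : A) ^ N)) :=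
  prod_range_succ _ _

lemma pol_deg (N : ℕ) : (pol N).natDegree = N := by
  unfold pol
  rw [Polynomial.natDegree_finsetProd_X_sub_C_eq_card]
  simp

lemma choose_succ_two (n : ℕ) : (n + 1).choose 2 = n + n.choose 2 := by
  rw [Nat.choose_succ_succ' n 1]; simp

lemma ch (r : ℕ) : 2 * r.choose 2 + r = r * r := by
  induction r with
  | zero => simp
  | succ n ih => rw [choose_succ_two]; nlinarith

lemma pol_coeff (N : ℕ) : ∀ a b : ℕ, a + b = N →
    (pol N).coeff a * (qp a * qp b) = (-1) ^ b * X ^ (b.choose 2) * qp N := by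
  induction N with
  | zero =>
    intro a b h
    obtain ⟨rfl, rfl⟩ : a = 0 ∧ b = 0 := by omega
    simp [pol, qp_zero]
  | succ N ih =>
    intro a b h
    rw [pol_succ, mul_sub, Polynomial.coeff_sub, Polynomial.coeff_mul_C]
    rcases a with _ | a
    · obtain rfl : b = N + 1 := by omega
      have h0 := ih 0 N (by omega)
      rw [Polynomial.coeff_mul_X_zero, qp_succ, choose_succ_two]
      linear_combination (- X ^ N * (1 - X ^ (N+1))) * h0
    · rw [Polynomial.coeff_mul_X]
      rcases b with _ | b
      · obtain rfl : a = N := by omega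
        have h0 := ih a 0 (by omega)
        rw [Polynomial.coeff_eq_zero_of_natDegree_lt (n := a + 1) (by rw [pol_deg]; omega), qp_succ]
        simp only [zero_mul, sub_zero]
        linear_combination (1 - X ^ (a+1)) * h0
      · have h1 := ih a (b+1) (by omega)
        have h2 := ih (a+1) b (by omega)
        obtain rfl : N = a + 1 + b := by omega
        rw [qp_succ (a + 1 + b)]
        rw [choose_succ_two] at h1 ⊢
        rw [qp_succ b] at h1 ⊢
        rw [qp_succ a] at h2 ⊢
        linear_combination (1 - X ^ (a+1)) * h1 - (X^(a+1+b)) * (1 - X^(b+1)) * h2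

lemma prod_pow (n : ℕ) : ∏ j ∈ range n, (X : A) ^ j = X ^ (n.choose 2) := by
  induction n with
  | zero => simp
  | succ n ih => rw [prod_range_succ, ih, choose_succ_two]; ring

lemma prod_low (n : ℕ) : ∏ j ∈ range n, ((X : A) ^ n - X ^ j) = (-1) ^ n * X ^ (n.choose 2) * qp n := by
  have h : ∀ j ∈ range n, (X : A) ^ n - X ^ j = (-1) * X ^ j * (1 - X ^ (n - 1 - j + 1)) := by
    intro j hj
    rw [mem_range] at hj
    have : n = j + (n - 1 - j + 1) := by omega
    conv_lhs => rw [this, pow_add]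
    ring
  rw [prod_congr rfl h, prod_mul_distrib, prod_mul_distrib, prod_pow, prod_const, card_range,
    prod_range_reflect (fun i => (1 : A) - X ^ (i + 1)) n]
  rfl

lemma prod_high (n : ℕ) : ∏ j ∈ range n, ((X : A) ^ n - X ^ (n + 1 + j)) = X ^ (n * n) * qp n := by
  have h : ∀ j ∈ range n, (X : A) ^ n - X ^ (n + 1 + j) = X ^ n * (1 - X ^ (j + 1)) := by
    intro j hj; ring
  rw [prod_congr rfl h, prod_mul_distrib, prod_const, card_range, ← pow_mul]
  rfl

lemma pol_deriv (n : ℕ) : (pol (2 * n + 1)).derivative.eval ((X : A) ^ n) =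
    (-1) ^ n * X ^ (n.choose 2 + n * n) * qp n ^ 2 := by
  have : pol (2 * n + 1) = (Polynomial.X - Polynomial.C ((X : A) ^ n)) *
     ((∏ j ∈ range n, (Polynomial.X - Polynomial.C ((X : A) ^ j))) *
      (∏ j ∈ range n, (Polynomial.X - Polynomial.C ((X : A) ^ (n + 1 + j))))) := by
    unfold pol
    rw [show 2 * n + 1 = n + 1 + n by ring, prod_range_add, prod_range_succ]
    ring
  rw [this, Polynomial.derivative_mul]
  simp only [Polynomial.derivative_sub, Polynomial.derivative_X, Polynomial.derivative_C, sub_zero,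
    one_mul, Polynomial.eval_add, Polynomial.eval_mul, Polynomial.eval_sub, Polynomial.eval_X,
    Polynomial.eval_C, sub_self, zero_mul, add_zero, Polynomial.eval_prod]
  rw [prod_low, prod_high]
  ring

lemma pol_deriv' (n : ℕ) : (X : A) ^ n * (pol (2 * n + 1)).derivative.eval ((X : A) ^ n) =
    ∑ k ∈ range (2 * n + 2), (k : A) * (pol (2 * n + 1)).coeff k * X ^ (n * k) := by
  rw [Polynomial.derivative_eval, Polynomial.sum_over_range' _ (by simp) (2 * n + 2) (by
    rw [pol_deg]; omega), mul_sum]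
  refine sum_congr rfl fun k _ => ?_
  rcases k with _ | k
  · simp
  · rw [Nat.add_sub_cancel, ← pow_mul, mul_add n, pow_add]; push_cast; ring

lemma sum_pair (n : ℕ) (f : ℕ → A) : ∑ k ∈ range (2 * n + 2), f k =
    ∑ m ∈ range (n + 1), (f (n + 1 + m) + f (n - m)) := by
  rw [show 2 * n + 2 = n + 1 + (n + 1) by ring, sum_range_add, sum_add_distrib, add_comm]
  congr 1
  rw [← sum_range_reflect]
  rfl

/-- The Gaussian binomial coefficient occurring in the finite Jacobi identity. -/
noncomputable def g (n m : ℕ) : A := qp (2 * n + 1) * (qp (n - m) * qp (n + 1 + m))⁻¹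

lemma D_inv (n m : ℕ) : (qp (n - m) * qp (n + 1 + m)) * (qp (n - m) * qp (n + 1 + m))⁻¹ = 1 := by
  apply PowerSeries.mul_inv_cancel
  simp [qp_const]

lemma sq (n : ℕ) : qp n ^ 2 = ∑ m ∈ range (n + 1),
    (-1) ^ m * (2 * m + 1 : A) * X ^ ((m + 1).choose 2) * g n m := by
  have h := pol_deriv' n
  rw [pol_deriv, sum_pair] at h
  have key : ∀ m ∈ range (n + 1),
      (((n + 1 + m : ℕ) : A) * (pol (2 * n + 1)).coeff (n + 1 + m) * X ^ (n * (n + 1 + m)) +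
      ((n - m : ℕ) : A) * (pol (2 * n + 1)).coeff (n - m) * X ^ (n * (n - m))) =
      ((-1) ^ n * X ^ (n + (n.choose 2 + n * n))) *
       ((-1) ^ m * (2 * m + 1 : A) * X ^ ((m + 1).choose 2) * g n m) := by
    intro m hm
    rw [mem_range] at hm
    obtain ⟨r, rfl⟩ : ∃ r, n = m + r := ⟨n - m, by omega⟩
    have h1 := pol_coeff (2 * (m + r) + 1) (m + r + 1 + m) r (by omega)
    have h2 := pol_coeff (2 * (m + r) + 1) r (m + r + 1 + m) (by omega)
    have hD := D_inv (m + r) m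
    unfold g
    rw [show m + r - m = r by omega] at hD ⊢
    set I := (qp r * qp (m + r + 1 + m))⁻¹
    set N := 2 * (m + r) + 1
    have e1 : m + r + ((m + r).choose 2 + (m + r) * (m + r)) + (m + 1).choose 2 =
        r.choose 2 + (m + r) * (m + r + 1 + m) := by
      have := ch r; have := ch (m + r); have := ch (m + 1); nlinarith
    have e2 : m + r + ((m + r).choose 2 + (m + r) * (m + r)) + (m + 1).choose 2 =
        (m + r + 1 + m).choose 2 + (m + r) * r := by
      have := ch (m + r + 1 + m); have := ch (m + r); have := ch (m + 1); nlinarith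
    have c1 : (pol N).coeff (m + r + 1 + m) = (-1) ^ r * X ^ (r.choose 2) * qp N * I := by
      linear_combination I * h1 - (pol N).coeff (m + r + 1 + m) * hD
    have c2 : (pol N).coeff r =
        (-1) ^ (m + r + 1 + m) * X ^ ((m + r + 1 + m).choose 2) * qp N * I := by
      linear_combination I * h2 - (pol N).coeff r * hD
    have s1 : (-1 : A) ^ (m + r) * (-1) ^ m = (-1) ^ r := by
      rw [← pow_add, show m + r + m = 2 * m + r by ring, pow_add, pow_mul]; simp
    have s2 : (-1 : A) ^ (m + r + 1 + m) = - (-1) ^ r := by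
      rw [show m + r + 1 + m = 2 * m + r + 1 by ring, pow_add, pow_add, pow_mul]; simp
    calc _ = ((m + r + 1 + m : ℕ) : A) * (-1) ^ r * qp N * I *
            X ^ (r.choose 2 + (m + r) * (m + r + 1 + m)) -
          (r : A) * (-1) ^ r * qp N * I * X ^ ((m + r + 1 + m).choose 2 + (m + r) * r) := by
            rw [c1, c2, s2, pow_add, pow_add]; ring
      _ = _ := by
            rw [← e1, ← e2, ← s1, pow_add _ _ ((m+1).choose 2)]; push_cast; ring
  rw [sum_congr rfl key, ← mul_sum] at h
  have hne : ((-1 : A) ^ n * X ^ (n + (n.choose 2 + n * n))) ≠ 0 := by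
    simp [PowerSeries.X_ne_zero]
  apply mul_left_cancel₀ hne
  rw [← h, pow_add]; ring

lemma cube (n : ℕ) : (X : A) ^ (n + 1) ∣ qp n ^ 3 - ∑ m ∈ range (n + 1),
    (-1) ^ m * (2 * m + 1 : A) * X ^ ((m + 1).choose 2) := by
  have : qp n ^ 3 - ∑ m ∈ range (n + 1), (-1) ^ m * (2 * m + 1 : A) * X ^ ((m + 1).choose 2) =
      ∑ m ∈ range (n + 1), ((-1) ^ m * (2 * m + 1 : A)) *
        (X ^ ((m + 1).choose 2) * (g n m * qp n - 1)) := by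
    rw [pow_succ, sq, sum_mul, ← sum_sub_distrib]
    exact sum_congr rfl fun m _ => by ring
  rw [this]
  refine dvd_sum fun m hm => Dvd.dvd.mul_left ?_ _
  rw [mem_range] at hm
  have hd : (X : A) ^ (n - m + 1) ∣ g n m * qp n - 1 := by
    have hD := D_inv n m
    set I := (qp (n - m) * qp (n + 1 + m))⁻¹ with hI
    have : g n m * qp n - 1 = I * ((qp (n - m + (n + m + 1)) - qp (n - m)) * qp n +
        qp (n - m) * ((qp (n - m + m) - qp (n - m)) - (qp (n - m + (2 * m + 1)) - qp (n - m)))) := by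
      rw [show n - m + (n + m + 1) = 2 * n + 1 by omega, show n - m + m = n by omega,
        show n - m + (2 * m + 1) = n + 1 + m by omega, g, ← hI]
      linear_combination hD
    rw [this]
    refine Dvd.dvd.mul_left (dvd_add (Dvd.dvd.mul_right (qp_dvd _ _) _)
      (Dvd.dvd.mul_left (dvd_sub (qp_dvd _ _) (qp_dvd _ _)) _)) _
  refine (pow_dvd_pow X ?_).trans ((pow_add (X : A) ((m + 1).choose 2) (n - m + 1)).symm ▸
    mul_dvd_mul_left _ hd)
  rw [choose_succ_two]; omega


open scoped PowerSeries.WithPiTopology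
open Filter Topology

noncomputable def G : A := PowerSeries.mk fun n => (P n : ZMod 7)

lemma hasProd_G : HasProd (fun i ↦ ∑' j : ℕ, (X : A) ^ ((i + 1) * j)) G := by
  have h := Nat.Partition.hasProd_powerSeriesMk_card_restricted (ZMod 7) (fun _ => True)
  simpa [Nat.Partition.restricted, G, P] using h

lemma G_mul : G * pentagonalSeries (ZMod 7) = 1 := by
  have h := hasProd_G.mul (PowerSeries.WithPiTopology.hasProd_one_sub_X_pow (ZMod 7))
  have e : (fun i : ℕ ↦ (∑' j : ℕ, (X : A) ^ ((i + 1) * j)) * (1 - X ^ (i + 1))) = fun _ => 1 := by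
    funext i
    simp_rw [pow_mul]
    exact PowerSeries.WithPiTopology.tsum_pow_mul_one_sub_of_constantCoeff_eq_zero (by simp)
  rw [e] at h
  exact h.unique hasProd_one

lemma coeff_cube (k : ℕ) (hk : coeff k (pentagonalSeries (ZMod 7) ^ 3) ≠ 0) :
    ∃ m : ℕ, (m + 1).choose 2 = k ∧ (2 * m + 1 : ZMod 7) ≠ 0 := by
  have h := (PowerSeries.WithPiTopology.hasProd_one_sub_X_pow (ZMod 7)).tendsto_prod_nat.pow 3
  rw [PowerSeries.WithPiTopology.tendsto_iff_coeff_tendsto] at h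
  have h := h k
  rw [nhds_discrete, tendsto_pure] at h
  obtain ⟨n, hn, hkn⟩ := (h.and (eventually_ge_atTop k)).exists
  rw [← hn] at hk
  have hc := X_pow_dvd_iff.mp (cube n) k (by omega)
  rw [map_sub, sub_eq_zero] at hc
  change coeff k (qp n ^ 3) ≠ 0 at hk
  rw [hc, map_sum] at hk
  obtain ⟨m, _, hm⟩ := exists_ne_zero_of_sum_ne_zero hk
  have e : ((-1) ^ m * (2 * m + 1 : A) * X ^ ((m + 1).choose 2)) =
      C ((-1) ^ m * (2 * m + 1 : ZMod 7)) * X ^ ((m + 1).choose 2) := by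
    simp only [map_mul, map_pow, map_neg, map_one, map_add, map_natCast, map_ofNat]
  rw [e, coeff_C_mul, coeff_X_pow] at hm
  refine ⟨m, ?_, ?_⟩
  · by_contra hne
    exact hm (by rw [if_neg (fun h => hne h.symm), mul_zero])
  · intro h0
    exact hm (by rw [h0]; simp)

lemma mod_aux : ∀ x y a b : ZMod 7, 2 * a = (x + 1) * x → 2 * b = (y + 1) * y → a + b = 5 →
    2 * x + 1 = 0 := by decide

lemma tri_cast (m : ℕ) : (2 * ((m + 1).choose 2 : ℕ) : ZMod 7) = (m + 1) * m := by
  have := ch (m + 1)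
  have h2 : 2 * (m + 1).choose 2 = (m + 1) * m := by nlinarith
  exact_mod_cast congrArg (Nat.cast (R := ZMod 7)) h2

lemma coeff_six (n : ℕ) (hn : (n : ZMod 7) = 5) :
    coeff n (pentagonalSeries (ZMod 7) ^ 6) = 0 := by
  rw [show 6 = 3 + 3 by rfl, pow_add, coeff_mul]
  refine sum_eq_zero fun p hp => ?_
  rw [HasAntidiagonal.mem_antidiagonal] at hp
  by_contra hne
  obtain ⟨x, hx, hx0⟩ := coeff_cube p.1 (left_ne_zero_of_mul hne)
  obtain ⟨y, hy, -⟩ := coeff_cube p.2 (right_ne_zero_of_mul hne)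
  refine hx0 (mod_aux x y p.1 p.2 (hx ▸ tri_cast x) (hy ▸ tri_cast y) ?_)
  rw [← hn, ← hp]; push_cast; rfl

lemma coeff_G_pow (n : ℕ) (hn : ¬ 7 ∣ n) : coeff n (G ^ 7) = 0 := by
  have h : (PowerSeries.expand 7 (by norm_num) G).map (frobenius (ZMod 7) 7) = G ^ 7 :=
    MvPowerSeries.map_frobenius_expand 7 (by norm_num) (f := G)
  rw [← h, PowerSeries.coeff_map, PowerSeries.coeff_expand_of_not_dvd _ _ _ hn, map_zero]

lemma ramanujan (n : ℕ) : (P (7 * n + 5) : ZMod 7) = 0 := by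
  have h : G = G ^ 7 * pentagonalSeries (ZMod 7) ^ 6 := by
    rw [show G ^ 7 * pentagonalSeries (ZMod 7) ^ 6 = G * (G * pentagonalSeries (ZMod 7)) ^ 6 by ring,
      G_mul]; simp
  have e : (P (7 * n + 5) : ZMod 7) = coeff (7 * n + 5) G := by simp [G]
  rw [e, h, coeff_mul]
  refine sum_eq_zero fun p hp => ?_
  rw [HasAntidiagonal.mem_antidiagonal] at hp
  by_cases hd : 7 ∣ p.1
  · rw [coeff_six, mul_zero]
    have h7 : (p.1 : ZMod 7) = 0 := (ZMod.natCast_eq_zero_iff _ _).mpr hd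
    have := congrArg (Nat.cast (R := ZMod 7)) hp
    push_cast at this
    rw [h7, show (7 : ZMod 7) = 0 from rfl] at this
    simpa using this
  · rw [coeff_G_pow _ hd, zero_mul]

lemma Q_add (m : ℕ) : Q 7 (m + 7) = Q 7 m + P m := by
  let e := Nat.Partition.partitionWithPartEquiv (n := m + 7) (a := 7) (by norm_num) (by omega)
  have h1 : Q 7 (m + 7) = ∑ p : {p : (m + 7).Partition // 7 ∈ p.parts}, p.1.parts.count 7 := by
    unfold Q
    rw [← Finset.sum_filter_of_ne (p := fun p : (m + 7).Partition => 7 ∈ p.parts)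
      (fun p _ h => Multiset.count_ne_zero.mp h)]
    exact Finset.sum_subtype _ (by simp) _
  rw [h1, ← Equiv.sum_comp e.symm]
  have h2 : ∀ p : (m + 7 - 7).Partition, (e.symm p).1.parts.count 7 = p.parts.count 7 + 1 := by
    intro p
    rw [Nat.Partition.partitionWithPartEquiv_symm_apply_parts]
    simp
  simp_rw [h2, Finset.sum_add_distrib]
  simp [Q, P]
  rfl

end Ram

theorem stmt_8 (n : ℕ) : Q 7 (7 * n + 5) ≡ 0 [MOD 7] := by
  rw [← ZMod.natCast_eq_natCast_iff]
  induction n with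
  | zero =>
    have : Q 7 5 = 0 := by
      unfold Q
      refine Finset.sum_eq_zero fun p _ => Multiset.count_eq_zero.mpr fun h => ?_
      have := Nat.Partition.le_of_mem_parts h
      omega
    simp [this]
  | succ n ih =>
    rw [show 7 * (n + 1) + 5 = 7 * n + 5 + 7 by ring, Ram.Q_add]
    push_cast at ih ⊢
    rw [ih, Ram.ramanujan, add_zero]
end
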